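/- Let f : ℝ^n → ℝ be a piecewise constant function with p ≥ n+1 pieces. Then there exists a linear threshold neural network with 2 hidden layers that computes f exactly and has size at most 3·(e·p/(n+1))^{n+1}, where e is Euler's number. -/

import Mathlib

open Finset MeasureTheory

noncomputable section

/-- The threshold activation function. -/
def thresh (t : ℝ) : ℝ := if 0 < t then 1 else 0

/-- `T` is an affine map from `ℝ^a` to `ℝ^b`. -/
def IsAffineMap {a b : ℕ} (T : (Fin a → ℝ) → (Fin b → ℝ)) : Prop :=
  ∃ (M : Fin b → Fin a → ℝ) (c : Fin b → ℝ),
    ∀ x j, T x j = (∑ i, M j i * x i) + c j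

/-- `Hidden n k s w g` : `g = σ ∘ T_k ∘ ⋯ ∘ σ ∘ T_1 : ℝ^n → ℝ^w` is the function computed
by `k` hidden threshold layers, where the last hidden layer has width `w` and the total
number of hidden neurons (the size) is `s`. -/
inductive Hidden (n : ℕ) : ℕ → ℕ → (w : ℕ) → ((Fin n → ℝ) → (Fin w → ℝ)) → Prop
  | single {w : ℕ} (T : (Fin n → ℝ) → (Fin w → ℝ)) (hT : IsAffineMap T) :
      Hidden n 1 w w (fun x j => thresh (T x j))
  | comp {k s w w' : ℕ} {g : (Fin n → ℝ) → (Fin w → ℝ)}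
      (T : (Fin w → ℝ) → (Fin w' → ℝ)) (hg : Hidden n k s w g) (hT : IsAffineMap T) :
      Hidden n (k + 1) (s + w') w' (fun x j => thresh (T (g x) j))

/-- `f : ℝ^n → ℝ` is computed by a linear threshold neural network with `k` hidden layers
and size (number of hidden neurons) `s`. -/
def LTComputes (n k s : ℕ) (f : (Fin n → ℝ) → ℝ) : Prop :=
  ∃ (w : ℕ) (g : (Fin n → ℝ) → (Fin w → ℝ)) (a : Fin w → ℝ) (c : ℝ),
    Hidden n k s w g ∧ ∀ x, f x = (∑ j, a j * g x j) + c

/-- A polyhedron in `ℝ^n`: the intersection of finitely many closed halfspaces. -/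
def IsPolyhedron {n : ℕ} (P : Set (Fin n → ℝ)) : Prop :=
  ∃ (m : ℕ) (a : Fin m → Fin n → ℝ) (b : Fin m → ℝ),
    P = {x | ∀ i, (∑ j, a i j * x j) ≤ b i}

/-- `F` is a face of the polyhedron `P`. -/
def IsFace {n : ℕ} (F P : Set (Fin n → ℝ)) : Prop :=
  ∃ (c : Fin n → ℝ) (d : ℝ),
    (∀ x ∈ P, (∑ j, c j * x j) ≤ d) ∧ F = {x ∈ P | (∑ j, c j * x j) = d}

/-- A (finite) polyhedral complex in `ℝ^n`. -/
def IsPolyhedralComplex {n : ℕ} (Pc : Finset (Set (Fin n → ℝ))) : Prop :=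
  (∀ P ∈ Pc, IsPolyhedron P) ∧
  (∀ P ∈ Pc, ∀ Q ∈ Pc, IsFace (P ∩ Q) P ∧ IsFace (P ∩ Q) Q) ∧
  (∀ P ∈ Pc, ∀ F, IsFace F P → F ∈ Pc)

/-- The union of the members of `Pc` is all of `ℝ^n`. -/
def Covers {n : ℕ} (Pc : Finset (Set (Fin n → ℝ))) : Prop :=
  ⋃₀ (Pc : Set (Set (Fin n → ℝ))) = Set.univ

/-- The dimension of a polyhedron: the dimension of its affine hull. -/
def polyDim {n : ℕ} (P : Set (Fin n → ℝ)) : ℕ :=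
  Module.finrank ℝ (affineSpan ℝ P).direction

/-- `Pc` is a polyhedral complex covering `ℝ^n` with which `f` is compatible as a piecewise
constant function: `f` is constant on the relative interior of each member of `Pc`. -/
def CompatiblePWC {n : ℕ} (f : (Fin n → ℝ) → ℝ) (Pc : Finset (Set (Fin n → ℝ))) : Prop :=
  IsPolyhedralComplex Pc ∧ Covers Pc ∧
    ∀ P ∈ Pc, ∃ c : ℝ, ∀ x ∈ intrinsicInterior ℝ P, f x = c

/-- `f : ℝ^n → ℝ` is piecewise constant. -/
def IsPWC {n : ℕ} (f : (Fin n → ℝ) → ℝ) : Prop := ∃ Pc, CompatiblePWC f Pc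

/-- The cardinality `|Pc*_f|` of a minimum-cardinality polyhedral complex compatible with `f`. -/
def minCardPWC {n : ℕ} (f : (Fin n → ℝ) → ℝ) : ℕ :=
  sInf {c : ℕ | ∃ Pc, CompatiblePWC f Pc ∧ Pc.card = c}

open scoped Matrix

/-- The affine hyperplane `c ⬝ᵥ x = d` (everything or nothing when `c = 0`). -/
def affineHyperplane {n : ℕ} (c : Fin n → ℝ) (d : ℝ) : AffineSubspace ℝ (Fin n → ℝ) where
  carrier := {x | c ⬝ᵥ x = d}
  smul_vsub_vadd_mem' := by
    intro t x y z hx hy hz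
    simp only [Set.mem_ofPred_eq, vsub_eq_sub, vadd_eq_add, dotProduct_add, dotProduct_smul,
      dotProduct_sub] at *
    rw [hx, hy, hz]; simp

theorem IsPolyhedron.convex {n : ℕ} {P : Set (Fin n → ℝ)} (hP : IsPolyhedron P) :
    Convex ℝ P := by
  obtain ⟨m, a, b, rfl⟩ := hP
  intro x hx y hy s t hs ht hst i
  have h1 : a i ⬝ᵥ x ≤ b i := hx i
  have h2 : a i ⬝ᵥ y ≤ b i := hy i
  change a i ⬝ᵥ (s • x + t • y) ≤ b i
  rw [dotProduct_add, dotProduct_smul, dotProduct_smul, smul_eq_mul, smul_eq_mul]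
  have : b i = s * b i + t * b i := by rw [← add_mul, hst, one_mul]
  rw [this]
  gcongr

theorem continuous_dotProduct_right {n : ℕ} (c : Fin n → ℝ) :
    Continuous fun x : Fin n → ℝ => c ⬝ᵥ x := by
  unfold dotProduct; fun_prop

theorem IsPolyhedron.isClosed {n : ℕ} {P : Set (Fin n → ℝ)} (hP : IsPolyhedron P) :
    IsClosed P := by
  obtain ⟨m, a, b, rfl⟩ := hP
  rw [Set.ofPred_forall]
  exact isClosed_iInter fun i => isClosed_le (continuous_dotProduct_right (a i)) continuous_const

/-- If a face of `P` contains an interior point of a segment in `P`, it contains its endpoints. -/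
theorem IsFace.mem_of_openSegment {n : ℕ} {F P : Set (Fin n → ℝ)} (hF : IsFace F P)
    {x y : Fin n → ℝ} {ε : ℝ} (hε : 0 < ε) (hx : x ∈ F) (hy : y ∈ P)
    (hz : x + ε • (x - y) ∈ P) : y ∈ F := by
  obtain ⟨c, d, hle, rfl⟩ := hF
  have h1 : c ⬝ᵥ y ≤ d := hle y hy
  have h2 : c ⬝ᵥ (x + ε • (x - y)) ≤ d := hle _ hz
  have h3 : c ⬝ᵥ x = d := hx.2
  rw [dotProduct_add, dotProduct_smul, dotProduct_sub, smul_eq_mul, h3] at h2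
  refine ⟨hy, le_antisymm h1 ?_⟩
  change d ≤ c ⬝ᵥ y
  have : ε * (d - c ⬝ᵥ y) ≤ 0 := by linarith
  nlinarith

theorem exists_pos_add_smul_mem {n : ℕ} {U : Set (Fin n → ℝ)} {x : Fin n → ℝ}
    (hU : U ∈ nhds x) (v : Fin n → ℝ) : ∃ ε : ℝ, 0 < ε ∧ x + ε • v ∈ U := by
  have hc : Filter.Tendsto (fun ε : ℝ => x + ε • v) (nhdsWithin 0 (Set.Ioi 0)) (nhds x) := by
    have : Continuous fun ε : ℝ => x + ε • v := by fun_prop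
    have h := this.tendsto 0
    simp only [zero_smul, add_zero] at h
    exact h.mono_left nhdsWithin_le_nhds
  obtain ⟨ε, h1, h2⟩ := ((hc.eventually hU).and self_mem_nhdsWithin).exists
  exact ⟨ε, h2, h1⟩

theorem IsFace.eq_of_mem_interior {n : ℕ} {F P : Set (Fin n → ℝ)} (hF : IsFace F P)
    {x : Fin n → ℝ} (hx : x ∈ F) (hi : x ∈ interior P) : F = P := by
  refine Set.Subset.antisymm ?_ fun y hy => ?_
  · obtain ⟨c, d, -, rfl⟩ := hF
    exact Set.sep_subset _ _
  · obtain ⟨ε, hε, h⟩ := exists_pos_add_smul_mem (mem_interior_iff_mem_nhds.1 hi) (x - y)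
    exact hF.mem_of_openSegment hε hx hy h

theorem IsFace.polyDim_lt {n : ℕ} {F P : Set (Fin n → ℝ)} (hF : IsFace F P)
    (hne : F.Nonempty) (h : F ≠ P) : polyDim F < polyDim P := by
  obtain ⟨c, d, hle, rfl⟩ := hF
  obtain ⟨y, hy, hyd⟩ : ∃ y ∈ P, c ⬝ᵥ y ≠ d := by
    by_contra! hc
    exact h (Set.Subset.antisymm (Set.sep_subset _ _) fun y hy => ⟨hy, hc y hy⟩)
  refine Submodule.finrank_lt_finrank_of_lt
    (AffineSubspace.direction_lt_of_nonempty (lt_of_le_of_ne ?_ ?_) ?_)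
  · exact affineSpan_mono ℝ (Set.sep_subset _ _)
  · intro heq
    have h1 : y ∈ affineSpan ℝ {x ∈ P | (∑ j, c j * x j) = d} := by
      rw [heq]; exact subset_affineSpan ℝ _ hy
    have h2 : affineSpan ℝ {x ∈ P | (∑ j, c j * x j) = d} ≤ affineHyperplane c d :=
      affineSpan_le.2 fun z hz => hz.2
    exact hyd (h2 h1)
  · exact (affineSpan_nonempty ℝ).2 hne

theorem IsPolyhedron.mem_intrinsicInterior {n : ℕ} {P : Set (Fin n → ℝ)} (hP : IsPolyhedron P)
    {x : Fin n → ℝ} (hx : x ∈ P) (hmin : ∀ F, IsFace F P → x ∈ F → F = P) :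
    x ∈ intrinsicInterior ℝ P := by
  obtain ⟨m, a, b, hPab⟩ := hP
  rw [_root_.mem_intrinsicInterior]
  refine ⟨⟨x, subset_affineSpan ℝ P hx⟩, ?_, rfl⟩
  rw [mem_interior_iff_mem_nhds]
  have key : ∀ i, ∀ᶠ y : affineSpan ℝ P in nhds ⟨x, subset_affineSpan ℝ P hx⟩,
      a i ⬝ᵥ (y : Fin n → ℝ) ≤ b i := by
    intro i
    have hxi : a i ⬝ᵥ x ≤ b i := by
      have := hx
      rw [hPab] at this
      exact this i
    rcases hxi.lt_or_eq with hlt | heq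
    · have hc : Continuous fun y : affineSpan ℝ P => a i ⬝ᵥ (y : Fin n → ℝ) :=
        (continuous_dotProduct_right (a i)).comp continuous_subtype_val
      filter_upwards [hc.continuousAt.eventually_lt continuousAt_const hlt] with y hy
      exact hy.le
    · have hface : {y ∈ P | (∑ j, a i j * y j) = b i} = P := by
        refine hmin _ ⟨a i, b i, fun y hy => ?_, rfl⟩ ⟨hx, heq⟩
        rw [hPab] at hy
        exact hy i
      have hle : affineSpan ℝ P ≤ affineHyperplane (a i) (b i) := by
        refine affineSpan_le.2 fun z hz => ?_
        rw [← hface] at hz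
        exact hz.2
      exact Filter.Eventually.of_forall fun y => (hle y.2 : a i ⬝ᵥ (y : Fin n → ℝ) = b i).le
  filter_upwards [Filter.eventually_all.2 key] with y hy
  exact hPab.symm ▸ (show (y : Fin n → ℝ) ∈ {x | ∀ i, (∑ j, a i j * x j) ≤ b i} from hy)

/-- The full-dimensional members of a collection of sets. -/
def maxCells {n : ℕ} (Pc : Finset (Set (Fin n → ℝ))) : Finset (Set (Fin n → ℝ)) :=
  open Classical in {P ∈ Pc | polyDim P = n}

theorem mem_maxCells {n : ℕ} {Pc : Finset (Set (Fin n → ℝ))} {P : Set (Fin n → ℝ)} :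
    P ∈ maxCells Pc ↔ P ∈ Pc ∧ polyDim P = n := by
  simp [maxCells]

/-- The full-dimensional members of `Pc` containing `x`. -/
def maxCellsAt {n : ℕ} (Pc : Finset (Set (Fin n → ℝ))) (x : Fin n → ℝ) :
    Finset (Set (Fin n → ℝ)) :=
  open Classical in {P ∈ maxCells Pc | x ∈ P}

theorem mem_maxCellsAt {n : ℕ} {Pc : Finset (Set (Fin n → ℝ))} {P : Set (Fin n → ℝ)}
    {x : Fin n → ℝ} : P ∈ maxCellsAt Pc x ↔ P ∈ maxCells Pc ∧ x ∈ P := by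
  simp [maxCellsAt]

/-- The full-dimensional cells of a complex covering the space already cover it. -/
theorem exists_mem_maxCells {n : ℕ} {Pc : Finset (Set (Fin n → ℝ))}
    (hPc : IsPolyhedralComplex Pc) (hcov : Covers Pc) (x : Fin n → ℝ) :
    ∃ P ∈ maxCells Pc, x ∈ P := by
  classical
  set U : Set (Fin n → ℝ) := ⋃ P ∈ maxCells Pc, P with hU
  have hclosed : IsClosed U :=
    (maxCells Pc).finite_toSet.isClosed_biUnion fun P hP =>
      (hPc.1 P (mem_maxCells.1 hP).1).isClosed
  have hsub : Uᶜ ⊆ ⋃ P ∈ Pc \ maxCells Pc, P := by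
    intro y hy
    have hy' : y ∈ ⋃₀ (Pc : Set (Set (Fin n → ℝ))) := by rw [hcov]; trivial
    obtain ⟨P, hP, hyP⟩ := hy'
    simp only [Set.mem_iUnion]
    refine ⟨P, Finset.mem_sdiff.2 ⟨hP, fun hM => hy ?_⟩, hyP⟩
    simp only [hU, Set.mem_iUnion]
    exact ⟨P, hM, hyP⟩
  have hnull : volume Uᶜ = 0 := by
    refine measure_mono_null hsub ((measure_biUnion_null_iff (Finset.countable_toSet _)).2 ?_)
    intro P hP
    have hP' := Finset.mem_sdiff.1 (Finset.mem_coe.1 hP)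
    refine measure_mono_null (subset_affineSpan ℝ P)
      (Measure.addHaar_affineSubspace volume _ fun htop => hP'.2 (mem_maxCells.2 ⟨hP'.1, ?_⟩))
    rw [polyDim, htop, AffineSubspace.direction_top, finrank_top, Module.finrank_fin_fun]
  have hempty : Uᶜ = ∅ := (hclosed.isOpen_compl.measure_eq_zero_iff volume).1 hnull
  have hx : x ∈ U := by
    by_contra h
    exact (Set.eq_empty_iff_forall_notMem.1 hempty x) h
  simpa [hU] using hx

/-- The intersection of the full-dimensional cells at `x` is contained in every cell at `x`. -/
theorem sInter_maxCellsAt_subset {n : ℕ} {Pc : Finset (Set (Fin n → ℝ))}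
    (hPc : IsPolyhedralComplex Pc) (hcov : Covers Pc) {x : Fin n → ℝ} {Q : Set (Fin n → ℝ)}
    (hQ : Q ∈ Pc) (hx : x ∈ Q) : ⋂₀ (maxCellsAt Pc x : Set (Set (Fin n → ℝ))) ⊆ Q := by
  classical
  intro y hy
  have hclosed : IsClosed (⋃ P ∈ (maxCells Pc \ maxCellsAt Pc x), P) :=
    (maxCells Pc \ maxCellsAt Pc x).finite_toSet.isClosed_biUnion fun P hP =>
      (hPc.1 P (mem_maxCells.1 (Finset.mem_sdiff.1 hP).1).1).isClosed
  have hxU : x ∈ (⋃ P ∈ (maxCells Pc \ maxCellsAt Pc x), P)ᶜ := by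
    simp only [Set.mem_compl_iff, Set.mem_iUnion, not_exists]
    intro P hP hxP
    have h := Finset.mem_sdiff.1 hP
    exact h.2 (mem_maxCellsAt.2 ⟨h.1, hxP⟩)
  obtain ⟨ε, hε, hz⟩ := exists_pos_add_smul_mem (hclosed.isOpen_compl.mem_nhds hxU) (x - y)
  obtain ⟨P, hP, hzP⟩ := exists_mem_maxCells hPc hcov (x + ε • (x - y))
  have hPx : P ∈ maxCellsAt Pc x := by
    by_contra hn
    refine hz ?_
    simp only [Set.mem_iUnion]
    exact ⟨P, Finset.mem_sdiff.2 ⟨hP, hn⟩, hzP⟩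
  have hface := (hPc.2.1 Q hQ P (mem_maxCells.1 hP).1).2
  exact (hface.mem_of_openSegment hε ⟨hx, (mem_maxCellsAt.1 hPx).2⟩ (hy P hPx) hzP).1

theorem exists_card_le_sInter_eq_aux {n : ℕ} {Pc : Finset (Set (Fin n → ℝ))}
    (hPc : IsPolyhedralComplex Pc) (x : Fin n → ℝ) (d : ℕ) :
    ∀ S ⊆ maxCellsAt Pc x, ⋂₀ (S : Set (Set (Fin n → ℝ))) ∈ Pc →
      polyDim (⋂₀ (S : Set (Set (Fin n → ℝ)))) = d → S.card + d ≤ n + 1 →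
      ∃ S' ⊆ maxCellsAt Pc x, S'.card ≤ n + 1 ∧ ⋂₀ (S' : Set (Set (Fin n → ℝ))) ∈ Pc ∧
        ⋂₀ (S' : Set (Set (Fin n → ℝ))) = ⋂₀ (maxCellsAt Pc x : Set (Set (Fin n → ℝ))) := by
  classical
  induction d using Nat.strong_induction_on with
  | _ d ih =>
    intro S hS hmem hd hcard
    by_cases h : ∀ P ∈ maxCellsAt Pc x, ⋂₀ (S : Set (Set (Fin n → ℝ))) ⊆ P
    · exact ⟨S, hS, by omega, hmem, Set.Subset.antisymm (Set.subset_sInter h)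
        (Set.sInter_subset_sInter (Finset.coe_subset.2 hS))⟩
    push Not at h
    obtain ⟨P, hP, hnot⟩ := h
    have hPPc : P ∈ Pc := (mem_maxCells.1 (mem_maxCellsAt.1 hP).1).1
    have hface := (hPc.2.1 _ hPPc _ hmem).2
    have hins : ⋂₀ ((insert P S : Finset (Set (Fin n → ℝ))) : Set (Set (Fin n → ℝ))) =
        P ∩ ⋂₀ (S : Set (Set (Fin n → ℝ))) := by
      rw [Finset.coe_insert, Set.sInter_insert]
    have hlt := hface.polyDim_lt
      ⟨x, (mem_maxCellsAt.1 hP).2, fun Q hQ => (mem_maxCellsAt.1 (hS hQ)).2⟩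
      (fun heq => hnot (Set.inter_eq_right.1 heq))
    have hc := Finset.card_insert_le P S
    rw [hd] at hlt
    refine ih _ hlt (insert P S) (Finset.insert_subset hP hS) ?_ (by rw [hins]) (by omega)
    rw [hins]
    exact hPc.2.2 _ hmem _ hface

/-- The smallest cell containing `x` is an intersection of at most `n + 1` full-dimensional
cells. -/
theorem exists_card_le_sInter_eq {n : ℕ} {Pc : Finset (Set (Fin n → ℝ))}
    (hPc : IsPolyhedralComplex Pc) (hcov : Covers Pc) (x : Fin n → ℝ) :
    ∃ S ⊆ maxCellsAt Pc x, S.card ≤ n + 1 ∧ ⋂₀ (S : Set (Set (Fin n → ℝ))) ∈ Pc ∧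
      ⋂₀ (S : Set (Set (Fin n → ℝ))) = ⋂₀ (maxCellsAt Pc x : Set (Set (Fin n → ℝ))) := by
  obtain ⟨P, hP, hx⟩ := exists_mem_maxCells hPc hcov x
  have hP' := mem_maxCells.1 hP
  refine exists_card_le_sInter_eq_aux hPc x n {P} ?_ ?_ ?_ ?_
  · exact Finset.singleton_subset_iff.2 (mem_maxCellsAt.2 ⟨hP, hx⟩)
  · simpa using hP'.1
  · simpa using hP'.2
  · simp [add_comm]

/-- Upper-sum inversion over a finite family of sets. -/
theorem exists_sum_superset_eq {X : Type*} (𝓕 : Finset (Set X)) (g : Set X → ℝ) :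
    ∃ h : Set X → ℝ, ∀ F ∈ 𝓕, g F = ∑ G ∈ 𝓕, h G * (open Classical in if F ⊆ G then 1 else 0) := by
  classical
  induction 𝓕 using Finset.strongInduction with
  | _ 𝓕 ih =>
    rcases 𝓕.eq_empty_or_nonempty with rfl | hne
    · exact ⟨0, by simp⟩
    obtain ⟨F₀, hF₀⟩ := 𝓕.exists_minimal hne
    obtain ⟨h, hh⟩ := ih (𝓕.erase F₀) (Finset.erase_ssubset hF₀.prop)
    set r := g F₀ - ∑ G ∈ 𝓕.erase F₀, h G * (if F₀ ⊆ G then 1 else 0) with hr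
    refine ⟨Function.update h F₀ r, fun F hF => ?_⟩
    have hs : ∑ G ∈ 𝓕.erase F₀, Function.update h F₀ r G * (if F ⊆ G then 1 else 0) =
        ∑ G ∈ 𝓕.erase F₀, h G * (if F ⊆ G then 1 else 0) :=
      Finset.sum_congr rfl fun G hG => by
        rw [Function.update_of_ne (Finset.ne_of_mem_erase hG)]
    rw [← Finset.add_sum_erase 𝓕 _ hF₀.prop, hs, Function.update_self]
    by_cases hFF : F = F₀
    · subst hFF
      simp [hr]
    · have hnot : ¬ F ⊆ F₀ := fun hsub => hFF (Set.Subset.antisymm hsub (hF₀.le_of_le hF hsub))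
      rw [if_neg hnot, mul_zero, zero_add]
      exact hh F (Finset.mem_erase.2 ⟨hFF, hF⟩)

/-- The families of at most `n + 1` full-dimensional cells. -/
def cellFamilies {n : ℕ} (Pc : Finset (Set (Fin n → ℝ))) :
    Finset (Finset (Set (Fin n → ℝ))) :=
  {S ∈ (maxCells Pc).powerset | S.card ≤ n + 1}

/-- A compatible function is a linear combination of indicators of intersections of at most
`n + 1` full-dimensional cells. -/
theorem CompatiblePWC.exists_eq_sum {n : ℕ} {f : (Fin n → ℝ) → ℝ}
    {Pc : Finset (Set (Fin n → ℝ))} (h : CompatiblePWC f Pc) :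
    ∃ α : cellFamilies Pc → ℝ, ∀ x, f x = ∑ S, α S *
      (open Classical in if ∀ P ∈ S.1, x ∈ P then 1 else 0) := by
  classical
  obtain ⟨hPc, hcov, hf⟩ := h
  choose! g hg using hf
  choose S hSsub hScard hSmem hSeq using exists_card_le_sInter_eq hPc hcov
  set F : (Fin n → ℝ) → Set (Fin n → ℝ) := fun x => ⋂₀ (S x : Set (Set (Fin n → ℝ))) with hF
  have hxF : ∀ x, x ∈ F x := fun x P hP => (mem_maxCellsAt.1 (hSsub x hP)).2
  have hFsub : ∀ x, ∀ Q ∈ Pc, x ∈ Q → F x ⊆ Q := fun x Q hQ hx => by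
    rw [hF]
    simp only [hSeq]
    exact sInter_maxCellsAt_subset hPc hcov hQ hx
  have hfg : ∀ x, f x = g (F x) := fun x => by
    refine hg (F x) (hSmem x) x ((hPc.1 _ (hSmem x)).mem_intrinsicInterior (hxF x) ?_)
    intro G hG hxG
    refine Set.Subset.antisymm ?_ (hFsub x G (hPc.2.2 _ (hSmem x) G hG) hxG)
    obtain ⟨c, d, -, rfl⟩ := hG
    exact Set.sep_subset _ _
  obtain ⟨h, hh⟩ := exists_sum_superset_eq {G ∈ Pc | ∃ x, F x = G} g
  have hspan : f ∈ Submodule.span ℝ (Set.range fun (T : cellFamilies Pc) (x : Fin n → ℝ) =>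
      if ∀ P ∈ T.1, x ∈ P then (1 : ℝ) else 0) := by
    have hfe : f = ∑ G ∈ Pc with ∃ x, F x = G, h G • fun x => if x ∈ G then (1 : ℝ) else 0 := by
      funext x
      rw [hfg, hh (F x) (Finset.mem_filter.2 ⟨hSmem x, x, rfl⟩), Finset.sum_apply]
      refine Finset.sum_congr rfl fun G hG => ?_
      have : F x ⊆ G ↔ x ∈ G :=
        ⟨fun hs => hs (hxF x), hFsub x G (Finset.mem_filter.1 hG).1⟩
      simp only [this, Pi.smul_apply, smul_eq_mul]
    rw [hfe]
    refine Submodule.sum_mem _ fun G hG => Submodule.smul_mem _ _ (Submodule.subset_span ?_)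
    obtain ⟨y, rfl⟩ := (Finset.mem_filter.1 hG).2
    refine ⟨⟨S y, Finset.mem_filter.2 ⟨Finset.mem_powerset.2 fun P hP => ?_, hScard y⟩⟩, ?_⟩
    · exact (mem_maxCellsAt.1 (hSsub y hP)).1
    · funext x
      simp [hF]
  obtain ⟨α, hα⟩ := (Submodule.mem_span_range_iff_exists_fun ℝ).1 hspan
  refine ⟨α, fun x => ?_⟩
  rw [← hα, Finset.sum_apply]
  rfl

theorem interior_nonempty_of_mem_maxCells {n : ℕ} (hn : n ≠ 0) {Pc : Finset (Set (Fin n → ℝ))}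
    (hPc : IsPolyhedralComplex Pc) {P : Set (Fin n → ℝ)} (hP : P ∈ maxCells Pc) :
    (interior P).Nonempty := by
  obtain ⟨hP, hdim⟩ := mem_maxCells.1 hP
  rw [(hPc.1 P hP).convex.interior_nonempty_iff_affineSpan_eq_top]
  have hne : P.Nonempty := by
    rw [Set.nonempty_iff_ne_empty]
    rintro rfl
    rw [polyDim, AffineSubspace.span_empty, AffineSubspace.direction_bot, finrank_bot] at hdim
    exact hn hdim.symm
  rw [← AffineSubspace.direction_eq_top_iff_of_nonempty ((affineSpan_nonempty ℝ).2 hne)]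
  refine Submodule.eq_top_of_finrank_eq ?_
  rw [Module.finrank_fin_fun]
  exact hdim

theorem disjoint_interior_of_mem_maxCells {n : ℕ} {Pc : Finset (Set (Fin n → ℝ))}
    (hPc : IsPolyhedralComplex Pc) {P Q : Set (Fin n → ℝ)} (hP : P ∈ Pc) (hQ : Q ∈ Pc)
    (hne : P ≠ Q) : Disjoint (interior P) Q := by
  rw [Set.disjoint_left]
  intro x hxP hxQ
  have hmem : x ∈ P ∩ Q := ⟨interior_subset hxP, hxQ⟩
  have h1 := (hPc.2.1 P hP Q hQ).1.eq_of_mem_interior hmem hxP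
  have hsub : P ⊆ Q := Set.inter_eq_left.1 h1
  have h2 := (hPc.2.1 P hP Q hQ).2.eq_of_mem_interior hmem (interior_mono hsub hxP)
  exact hne (h1.symm.trans h2)

/-- Full-dimensional cells are cut out by one halfspace for each other full-dimensional cell. -/
theorem exists_separating_halfspaces {n : ℕ} (hn : n ≠ 0) {Pc : Finset (Set (Fin n → ℝ))}
    (hPc : IsPolyhedralComplex Pc) (hcov : Covers Pc) :
    ∃ (A : Set (Fin n → ℝ) → Set (Fin n → ℝ) → Fin n → ℝ)
      (u : Set (Fin n → ℝ) → Set (Fin n → ℝ) → ℝ), ∀ P ∈ maxCells Pc, ∀ x,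
        x ∈ P ↔ ∀ Q ∈ maxCells Pc, P ≠ Q → A P Q ⬝ᵥ x ≤ u P Q := by
  have hsep : ∀ P Q : Set (Fin n → ℝ), ∃ (c : Fin n → ℝ) (d : ℝ),
      P ∈ maxCells Pc → Q ∈ maxCells Pc → P ≠ Q →
        (∀ x ∈ interior P, c ⬝ᵥ x < d) ∧ ∀ x ∈ Q, d ≤ c ⬝ᵥ x := by
    intro P Q
    by_cases h : P ∈ maxCells Pc ∧ Q ∈ maxCells Pc ∧ P ≠ Q
    · obtain ⟨hP, hQ, hne⟩ := h
      have hP' := (mem_maxCells.1 hP).1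
      have hQ' := (mem_maxCells.1 hQ).1
      obtain ⟨φ, d, h1, h2⟩ := geometric_hahn_banach_open (hPc.1 P hP').convex.interior
        isOpen_interior (hPc.1 Q hQ').convex (disjoint_interior_of_mem_maxCells hPc hP' hQ' hne)
      have hφ : ∀ x, (fun i => φ (Pi.single i 1)) ⬝ᵥ x = φ x := fun x => by
        have := LinearMap.pi_apply_eq_sum_univ (φ : (Fin n → ℝ) →ₗ[ℝ] ℝ) x
        simp only [dotProduct]
        refine Eq.trans ?_ this.symm
        refine Finset.sum_congr rfl fun i _ => ?_
        have hsingle : (Pi.single i 1 : Fin n → ℝ) = fun j => if i = j then 1 else 0 := by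
          funext j
          simp [Pi.single_apply, eq_comm]
        rw [smul_eq_mul, mul_comm, hsingle]
        rfl
      exact ⟨fun i => φ (Pi.single i 1), d, fun _ _ _ =>
        ⟨fun x hx => (hφ x).trans_lt (h1 x hx), fun x hx => (h2 x hx).trans_eq (hφ x).symm⟩⟩
    · exact ⟨0, 0, fun hP hQ hne => (h ⟨hP, hQ, hne⟩).elim⟩
  choose A u hAu using hsep
  refine ⟨A, u, fun P hP x => ?_⟩
  have hconv := (hPc.1 P (mem_maxCells.1 hP).1).convex
  have hclosed := (hPc.1 P (mem_maxCells.1 hP).1).isClosed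
  have hint := interior_nonempty_of_mem_maxCells hn hPc hP
  constructor
  · intro hx Q hQ hne
    have hx' : x ∈ closure (interior P) := by
      rw [hconv.closure_interior_eq_closure_of_nonempty_interior hint]
      exact subset_closure hx
    exact closure_minimal (fun y hy => ((hAu P Q hP hQ hne).1 y hy).le)
      (isClosed_le (continuous_dotProduct_right (A P Q)) continuous_const) hx'
  · intro hx
    obtain ⟨y, hy⟩ := hint
    have hseg : openSegment ℝ y x ⊆ P := by
      rintro z ⟨s, t, hs, ht, hst, rfl⟩
      obtain ⟨Q, hQ, hzQ⟩ := exists_mem_maxCells hPc hcov (s • y + t • x)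
      by_cases hne : P = Q
      · rwa [hne]
      have h1 := (hAu P Q hP hQ hne).1 y hy
      have h2 := hx Q hQ hne
      have h3 := (hAu P Q hP hQ hne).2 _ hzQ
      rw [dotProduct_add, dotProduct_smul, dotProduct_smul, smul_eq_mul, smul_eq_mul] at h3
      have h4 : s * u P Q + t * u P Q = u P Q := by rw [← add_mul, hst, one_mul]
      have h5 := mul_lt_mul_of_pos_left h1 hs
      have h6 := mul_le_mul_of_nonneg_left h2 ht.le
      linarith
    have : x ∈ closure (openSegment ℝ y x) := by
      rw [closure_openSegment]
      exact right_mem_segment ℝ y x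
    exact closure_minimal hseg hclosed this

theorem ltComputes_two_layers {n : ℕ} {ι κ : Type*} [Fintype ι] [Fintype κ]
    (A : ι → Fin n → ℝ) (b : ι → ℝ) (W : κ → ι → ℝ) (θ α : κ → ℝ) :
    LTComputes n 2 (Fintype.card ι + Fintype.card κ)
      (fun x => ∑ k, α k * thresh ((∑ i, W k i * thresh (A i ⬝ᵥ x + b i)) + θ k)) := by
  let e := Fintype.equivFin ι
  let e' := Fintype.equivFin κ
  refine ⟨Fintype.card κ, _, fun j => α (e'.symm j), 0,
    Hidden.comp
      (fun y j => (∑ i, W (e'.symm j) (e.symm i) * y i) + θ (e'.symm j))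
      (Hidden.single (fun x i => (∑ j, A (e.symm i) j * x j) + b (e.symm i))
        ⟨fun i => A (e.symm i), fun i => b (e.symm i), fun _ _ => rfl⟩)
      ⟨fun j i => W (e'.symm j) (e.symm i), fun j => θ (e'.symm j), fun _ _ => rfl⟩, ?_⟩
  intro x
  rw [add_zero]
  refine (e'.symm.sum_comp _).symm.trans (Finset.sum_congr rfl fun k _ => ?_)
  rw [← e.symm.sum_comp]
  rfl

theorem CompatiblePWC.ltComputes {n : ℕ} (hn : n ≠ 0) {f : (Fin n → ℝ) → ℝ}
    {Pc : Finset (Set (Fin n → ℝ))} (h : CompatiblePWC f Pc) :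
    LTComputes n 2 ((maxCells Pc).card * (maxCells Pc).card - (maxCells Pc).card +
      (cellFamilies Pc).card) f := by
  classical
  obtain ⟨α, hα⟩ := h.exists_eq_sum
  obtain ⟨A, u, hAu⟩ := exists_separating_halfspaces hn h.1 h.2.1
  have key := ltComputes_two_layers (ι := (maxCells Pc).offDiag) (κ := cellFamilies Pc)
    (fun i => A i.1.1 i.1.2) (fun i => -u i.1.1 i.1.2)
    (fun S i => if i.1.1 ∈ S.1 then -1 else 0) (fun _ => 1 / 2) α
  rw [Fintype.card_coe, Fintype.card_coe, Finset.offDiag_card] at key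
  convert key using 2 with x
  rw [hα x]
  refine Finset.sum_congr rfl fun S _ => ?_
  congr 1
  have hSM : ∀ P ∈ S.1, P ∈ maxCells Pc := fun P hP =>
    Finset.mem_powerset.1 (Finset.mem_filter.1 S.2).1 hP
  by_cases hx : ∀ P ∈ S.1, x ∈ P
  · rw [if_pos hx, Finset.sum_eq_zero]
    · simp [thresh]
    · rintro ⟨⟨P, Q⟩, hPQ⟩ -
      obtain ⟨hP, hQ, hne⟩ := Finset.mem_offDiag.1 hPQ
      by_cases hPS : P ∈ S.1
      · have := (hAu P hP x).1 (hx P hPS) Q hQ hne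
        have h0 : ¬ 0 < A P Q ⬝ᵥ x + -u P Q := by linarith
        simp [thresh, h0]
      · simp [hPS]
  · rw [if_neg hx]
    push Not at hx
    obtain ⟨P, hPS, hxP⟩ := hx
    have hn' := (hAu P (hSM P hPS) x).not.1 hxP
    push Not at hn'
    obtain ⟨Q, hQ, hne, hlt⟩ := hn'
    have hle := Finset.sum_le_sum_of_subset_of_nonneg (s := {(⟨(P, Q), Finset.mem_offDiag.2
        ⟨hSM P hPS, hQ, hne⟩⟩ : (maxCells Pc).offDiag)}) (t := Finset.univ)
      (f := fun i => (if i.1.1 ∈ S.1 then (1 : ℝ) else 0) *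
        thresh (A i.1.1 i.1.2 ⬝ᵥ x + -u i.1.1 i.1.2)) (Finset.subset_univ _)
      (fun i _ _ => by unfold thresh; positivity)
    have h0 : 0 < A P Q ⬝ᵥ x + -u P Q := by linarith
    rw [Finset.sum_singleton] at hle
    simp only [hPS, if_true, thresh, h0, mul_one] at hle
    have hneg : ∑ i : (maxCells Pc).offDiag, (if i.1.1 ∈ S.1 then (-1 : ℝ) else 0) *
        thresh (A i.1.1 i.1.2 ⬝ᵥ x + -u i.1.1 i.1.2) =
        -∑ i : (maxCells Pc).offDiag, (if i.1.1 ∈ S.1 then (1 : ℝ) else 0) *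
        thresh (A i.1.1 i.1.2 ⬝ᵥ x + -u i.1.1 i.1.2) := by
      rw [← Finset.sum_neg_distrib]
      refine Finset.sum_congr rfl fun i _ => ?_
      split_ifs <;> ring
    rw [hneg, thresh, if_neg]
    simp only [thresh]
    linarith

theorem card_cellFamilies {n : ℕ} (Pc : Finset (Set (Fin n → ℝ))) :
    (cellFamilies Pc).card = ∑ i ∈ Finset.range (n + 2), (maxCells Pc).card.choose i := by
  classical
  have : cellFamilies Pc =
      (Finset.range (n + 2)).biUnion fun i => (maxCells Pc).powersetCard i := by
    ext S
    simp only [cellFamilies, Finset.mem_filter, Finset.mem_powerset, Finset.mem_biUnion,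
      Finset.mem_range, Finset.mem_powersetCard]
    constructor
    · rintro ⟨h1, h2⟩
      exact ⟨S.card, by omega, h1, rfl⟩
    · rintro ⟨i, h1, h2, rfl⟩
      exact ⟨h2, by omega⟩
  rw [this, Finset.card_biUnion]
  · simp
  · intro i _ j _ hij
    exact Finset.pairwise_disjoint_powersetCard _ hij

theorem sum_range_choose_le_exp_mul_div_pow {p d : ℕ} (hd : 0 < d) (hdp : d ≤ p) :
    ((∑ i ∈ Finset.range (d + 1), p.choose i : ℕ) : ℝ) ≤ (Real.exp 1 * p / d) ^ d := by
  have hd' : (0 : ℝ) < d := by exact_mod_cast hd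
  have hp' : (0 : ℝ) < p := by exact_mod_cast hd.trans_le hdp
  have hr0 : (0 : ℝ) < d / p := by positivity
  have hr1 : (d / p : ℝ) ≤ 1 := (div_le_one hp').2 (by exact_mod_cast hdp)
  have h1 : ((∑ i ∈ Finset.range (d + 1), p.choose i : ℕ) : ℝ) * (d / p : ℝ) ^ d ≤
      Real.exp d := by
    calc ((∑ i ∈ Finset.range (d + 1), p.choose i : ℕ) : ℝ) * (d / p : ℝ) ^ d
        = ∑ i ∈ Finset.range (d + 1), (d / p : ℝ) ^ d * (p.choose i : ℝ) := by
          push_cast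
          rw [mul_comm, Finset.mul_sum]
      _ ≤ ∑ i ∈ Finset.range (d + 1), (d / p : ℝ) ^ i * (p.choose i : ℝ) := by
          refine Finset.sum_le_sum fun i hi => ?_
          have hi' : i ≤ d := by simpa [Nat.lt_succ_iff] using hi
          exact mul_le_mul_of_nonneg_right (pow_le_pow_of_le_one hr0.le hr1 hi')
            (Nat.cast_nonneg _)
      _ ≤ ∑ i ∈ Finset.range (p + 1), (d / p : ℝ) ^ i * (p.choose i : ℝ) := by
          refine Finset.sum_le_sum_of_subset_of_nonneg
            (Finset.range_subset_range.2 (by omega)) fun i _ _ => by positivity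
      _ = (d / p + 1 : ℝ) ^ p := by simp [add_pow]
      _ ≤ Real.exp (d / p) ^ p := by
          gcongr
          exact Real.add_one_le_exp _
      _ = Real.exp d := by
          rw [← Real.exp_nat_mul]
          congr 1
          field_simp
  have h2 : (Real.exp 1 * p / d) ^ d = Real.exp d / (d / p : ℝ) ^ d := by
    rw [show Real.exp d = Real.exp 1 ^ d by rw [← Real.exp_nat_mul, mul_one], ← div_pow]
    congr 1
    field_simp
  rw [h2, le_div_iff₀ (by positivity)]
  exact h1

theorem ncard_maxCells {n : ℕ} (Pc : Finset (Set (Fin n → ℝ))) :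
    {P ∈ (Pc : Set (Set (Fin n → ℝ))) | polyDim P = n}.ncard = (maxCells Pc).card := by
  rw [← Set.ncard_coe_finset]
  congr 1
  ext P
  simp [mem_maxCells]

/-- if `f : ℝ^n → ℝ` is piecewise constant with `p ≥ n+1` pieces, then `f` is
computed exactly by a linear threshold NN with 2 hidden layers whose size is at most
`3·(e·p/(n+1))^(n+1)`. -/
theorem stmt_7 (n p : ℕ) (f : (Fin n → ℝ) → ℝ)
    (Pc : Finset (Set (Fin n → ℝ))) (hPc : CompatiblePWC f Pc)
    (hmin : ∀ Qc : Finset (Set (Fin n → ℝ)), CompatiblePWC f Qc → Pc.card ≤ Qc.card)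
    (hpieces : {P ∈ (Pc : Set (Set (Fin n → ℝ))) | polyDim P = n}.ncard = p)
    (hpn : n + 1 ≤ p) :
    ∃ s : ℕ, LTComputes n 2 s f ∧
      (s : ℝ) ≤ 3 * (Real.exp 1 * p / (n + 1)) ^ (n + 1) := by
  rw [ncard_maxCells] at hpieces
  rcases Nat.eq_zero_or_pos n with rfl | hn
  · refine ⟨0, ⟨0, _, fun _ => 0, f 0, Hidden.comp (w' := 0) (fun _ j => j.elim0)
      (Hidden.single (w := 0) (fun _ j => j.elim0) ⟨0, 0, fun _ j => j.elim0⟩)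
      ⟨0, 0, fun _ j => j.elim0⟩, fun x => ?_⟩, ?_⟩
    · simp [Subsingleton.elim x 0]
    · rw [Nat.cast_zero]
      positivity
  refine ⟨_, hPc.ltComputes hn.ne', ?_⟩
  have hbound := sum_range_choose_le_exp_mul_div_pow (Nat.succ_pos n) hpn
  rw [card_cellFamilies, hpieces]
  have hchoose : p.choose 2 ≤ ∑ i ∈ Finset.range (n + 2), p.choose i :=
    Finset.single_le_sum (f := fun i => p.choose i) (fun _ _ => Nat.zero_le _)
      (Finset.mem_range.2 (by omega))
  have htwo : p * p - p = 2 * p.choose 2 := by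
    rw [Nat.choose_two_right, Nat.mul_div_cancel' (Nat.even_mul_pred_self p).two_dvd,
      Nat.mul_sub, mul_one]
  have hnat : p * p - p + ∑ i ∈ Finset.range (n + 2), p.choose i ≤
      3 * ∑ i ∈ Finset.range (n + 2), p.choose i := by omega
  calc ((p * p - p + ∑ i ∈ Finset.range (n + 2), p.choose i : ℕ) : ℝ)
      ≤ ((3 * ∑ i ∈ Finset.range (n + 2), p.choose i : ℕ) : ℝ) := by exact_mod_cast hnat
    _ = 3 * ((∑ i ∈ Finset.range (n + 2), p.choose i : ℕ) : ℝ) := by push_cast; rfl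
    _ ≤ 3 * (Real.exp 1 * p / (n + 1)) ^ (n + 1) := by
        have h : ((n.succ : ℕ) : ℝ) = n + 1 := by push_cast; rfl
        rw [h] at hbound
        exact mul_le_mul_of_nonneg_left hbound (by norm_num)
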